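/- Let a ≥ 1, b ≥ 0 and let L = U^a ⊕ E₈(−1)^b. Suppose v ∈ L ⊗ ℚ with v ∉ L, and let x be any real number. Then there exists a lattice vector μ ∈ L such that |⟨v − μ, v − μ⟩ − x| < 1. -/

import Mathlib

noncomputable section

open scoped BigOperators

/-- Index type for the even unimodular lattice `U^a ⊕ E₈(-1)^b`. -/
abbrev LIdx (a b : ℕ) := (Fin a × Fin 2) ⊕ (Fin b × Fin 8)

/-- Elements of the lattice `U^a ⊕ E₈(-1)^b`. -/
abbrev LVec (a b : ℕ) := LIdx a b → ℤ

/-- The Gram matrix of `U^a ⊕ E₈(-1)^b`. -/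
def gramL (a b : ℕ) : LIdx a b → LIdx a b → ℤ := fun i j =>
  match i, j with
  | Sum.inl (k, s), Sum.inl (k', s') => if k = k' ∧ s ≠ s' then 1 else 0
  | Sum.inr (k, s), Sum.inr (k', s') => if k = k' then -(CartanMatrix.E₈ s s') else 0
  | _, _ => 0

/-- The ℚ-bilinear extension of the form of `U^a ⊕ E₈(-1)^b` to `L ⊗ ℚ`. -/
def BLQ (a b : ℕ) (x y : LIdx a b → ℚ) : ℚ :=
  ∑ i, ∑ j, x i * (gramL a b i j : ℚ) * y j

/-- The inverse of the Cartan matrix of type `E₈`. -/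
def cartanE₈Inv : Matrix (Fin 8) (Fin 8) ℤ :=
  !![ 4,  5,  7, 10,  8,  6,  4,  2;
      5,  8, 10, 15, 12,  9,  6,  3;
      7, 10, 14, 20, 16, 12,  8,  4;
     10, 15, 20, 30, 24, 18, 12,  6;
      8, 12, 16, 24, 20, 15, 10,  5;
      6,  9, 12, 18, 15, 12,  8,  4;
      4,  6,  8, 12, 10,  8,  6,  3;
      2,  3,  4,  6,  5,  4,  3,  2]

theorem sum_cartanE₈_mul_inv (i s : Fin 8) :
    ∑ t, CartanMatrix.E₈ i t * cartanE₈Inv s t = if i = s then 1 else 0 := by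
  revert i s
  decide

theorem even_cartanE₈Inv_diag (s : Fin 8) : Even (cartanE₈Inv s s) := by
  revert s
  decide

theorem gramL_symm (a b : ℕ) (i j : LIdx a b) : gramL a b i j = gramL a b j i := by
  rcases i with ⟨k, s⟩ | ⟨k, s⟩ <;> rcases j with ⟨l, t⟩ | ⟨l, t⟩ <;> simp only [gramL]
  · simp only [eq_comm, ne_comm]
  · simp only [eq_comm (a := k), CartanMatrix.E₈_isSymm.apply t s]

theorem BLQ_comm (a b : ℕ) (x y : LIdx a b → ℚ) : BLQ a b x y = BLQ a b y x := by
  unfold BLQ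
  rw [Finset.sum_comm]
  refine Finset.sum_congr rfl fun i _ => Finset.sum_congr rfl fun j _ => ?_
  rw [gramL_symm]
  ring

theorem BLQ_sub_left (a b : ℕ) (x y z : LIdx a b → ℚ) :
    BLQ a b (x - y) z = BLQ a b x z - BLQ a b y z := by
  simp only [BLQ, Pi.sub_apply, sub_mul, Finset.sum_sub_distrib]

theorem BLQ_sub_self (a b : ℕ) (x y : LIdx a b → ℚ) :
    BLQ a b (x - y) (x - y) = BLQ a b x x - 2 * BLQ a b x y + BLQ a b y y := by
  rw [BLQ_sub_left, BLQ_comm a b x (x - y), BLQ_comm a b y (x - y), BLQ_sub_left, BLQ_sub_left,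
    BLQ_comm a b y x]
  ring

/-- The lattice vector with entries `m, n` in the `k`-th hyperbolic plane and zero elsewhere. -/
def hyperbolicVec (a b : ℕ) (k : Fin a) (m n : ℤ) : LVec a b
  | Sum.inl (l, s) => if l = k then (if s = 0 then m else n) else 0
  | Sum.inr _ => 0

/-- Up to sign, the lattice vector dual to the basis vector `s` of the `k`-th copy of `E₈(-1)`. -/
def dualE₈Vec (a b : ℕ) (k : Fin b) (s : Fin 8) : LVec a b
  | Sum.inl _ => 0
  | Sum.inr (l, t) => if l = k then cartanE₈Inv s t else 0

theorem BLQ_hyperbolicVec (a b : ℕ) (k : Fin a) (m n : ℤ) (v : LIdx a b → ℚ) :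
    BLQ a b v (fun i => (hyperbolicVec a b k m n i : ℚ)) =
      v (Sum.inl (k, 0)) * n + v (Sum.inl (k, 1)) * m := by
  simp [BLQ, gramL, hyperbolicVec, Fintype.sum_sum_type, Fintype.sum_prod_type, Fin.sum_univ_two,
    Finset.sum_add_distrib]
  ring

theorem BLQ_dualE₈Vec (a b : ℕ) (k : Fin b) (s : Fin 8) (v : LIdx a b → ℚ) :
    BLQ a b v (fun i => (dualE₈Vec a b k s i : ℚ)) = -v (Sum.inr (k, s)) := by
  have h : ∀ i : Fin 8, ∑ t, (CartanMatrix.E₈ i t : ℚ) * (cartanE₈Inv s t : ℚ) =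
      if i = s then 1 else 0 := fun i => by exact_mod_cast sum_cartanE₈_mul_inv i s
  have hsum : BLQ a b v (fun i => (dualE₈Vec a b k s i : ℚ)) =
      ∑ i, -v (Sum.inr (k, i)) *
        ∑ t, (CartanMatrix.E₈ i t : ℚ) * (cartanE₈Inv s t : ℚ) := by
    simp only [BLQ, gramL, dualE₈Vec, Fintype.sum_sum_type, Fintype.sum_prod_type]
    simp only [Int.cast_zero, mul_zero, zero_mul, Finset.sum_const_zero, zero_add]
    rw [Finset.sum_eq_single k]
    · refine Finset.sum_congr rfl fun i _ => ?_
      rw [Finset.sum_eq_single k]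
      · rw [Finset.mul_sum]
        refine Finset.sum_congr rfl fun t _ => ?_
        simp
        ring
      · intro l _ hl
        simp [hl]
      · simp
    · intro l _ hl
      refine Finset.sum_eq_zero fun i _ => Finset.sum_eq_zero fun l' _ =>
        Finset.sum_eq_zero fun t _ => ?_
      by_cases h' : l' = k
      · subst h'
        simp [hl]
      · simp [h']
    · simp
  simp [hsum, h]

theorem BLQ_sub_hyperbolicVec (a b : ℕ) (k : Fin a) (m n : ℤ) (v : LIdx a b → ℚ) :
    BLQ a b (v - fun i => (hyperbolicVec a b k m n i : ℚ))
        (v - fun i => (hyperbolicVec a b k m n i : ℚ)) =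
      BLQ a b v v - 2 * (v (Sum.inl (k, 0)) * n + v (Sum.inl (k, 1)) * m) + 2 * m * n := by
  rw [BLQ_sub_self, BLQ_hyperbolicVec, BLQ_hyperbolicVec]
  simp [hyperbolicVec]
  ring

/-- Translating by integers, a rational hyperbolic plane with a nonintegral coordinate `p`
represents numbers close to any real number. -/
theorem exists_int_hyperbolic_close (p q c : ℚ) (hp : ¬ ∃ z : ℤ, p = z) (x : ℝ) :
    ∃ m n : ℤ, |((c - 2 * (p * n + q * m) + 2 * m * n : ℚ) : ℝ) - x| < 1 := by
  set d : ℝ := (p : ℝ) - round p with hd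
  have hd0 : d ≠ 0 := by
    intro h
    refine hp ⟨round p, ?_⟩
    have : (p : ℝ) = ((round p : ℤ) : ℝ) := by linarith
    exact_mod_cast this
  have hd1 : |d| ≤ 1 / 2 := by
    have h := abs_sub_round p
    rw [hd]
    have h' := (Rat.cast_le (K := ℝ)).2 h
    push_cast at h'
    exact h'
  set y : ℝ := ((c : ℝ) - 2 * q * round p - x) / (2 * d) with hy
  refine ⟨round p, round y, ?_⟩
  have hval : ((c - 2 * (p * (round y : ℤ) + q * (round p : ℤ)) +
      2 * (round p : ℤ) * (round y : ℤ) : ℚ) : ℝ) - x = 2 * d * (y - round y) := by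
    have : 2 * d * y = (c : ℝ) - 2 * q * round p - x := by
      rw [hy]
      field_simp
    push_cast
    rw [mul_sub, this, hd]
    ring
  rw [hval, abs_mul, abs_mul, abs_two]
  have hr := abs_sub_round y
  nlinarith [abs_nonneg d, abs_nonneg (y - round y)]

theorem exists_even_translate_close_or_odd (r : ℝ) :
    (∃ n : ℤ, |r + 2 * n| < 1) ∨ ∃ n : ℤ, r = 2 * n + 1 := by
  by_cases h : r = 2 * ⌊r / 2⌋ + 1
  · exact Or.inr ⟨_, h⟩
  · left
    have h1 := Int.floor_le (r / 2)
    have h2 := Int.lt_floor_add_one (r / 2)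
    rcases lt_or_gt_of_ne h with h | h
    · refine ⟨-⌊r / 2⌋, ?_⟩
      rw [abs_lt]
      push_cast
      constructor <;> linarith
    · refine ⟨-⌊r / 2⌋ - 1, ?_⟩
      rw [abs_lt]
      push_cast
      constructor <;> linarith

/-- If the coordinates of `v` in a hyperbolic plane are integral, the values of the form on the
coset of `v` are stable under translation by even integers. -/
theorem exists_BLQ_sub_eq_add_two_mul (a b : ℕ) (k : Fin a) (v : LIdx a b → ℚ) (p q : ℤ)
    (hp : v (Sum.inl (k, 0)) = p) (hq : v (Sum.inl (k, 1)) = q) (n : ℤ) :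
    ∃ μ : LVec a b, BLQ a b (v - fun i => (μ i : ℚ)) (v - fun i => (μ i : ℚ)) =
      BLQ a b v v + 2 * n := by
  refine ⟨hyperbolicVec a b k (p + 1) (n + (p + 1) * q), ?_⟩
  rw [BLQ_sub_hyperbolicVec, hp, hq]
  push_cast
  ring

/-- If `v ∈ L ⊗ ℚ` does not lie in the lattice `L = U^a ⊕ E₈(-1)^b`, then for any real `x`
there is a lattice vector `μ ∈ L` with `|⟨v-μ, v-μ⟩ - x| < 1`. -/
theorem statement7 (a b : ℕ) (ha : 1 ≤ a) (v : LIdx a b → ℚ)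
    (hv : ¬ ∃ w : LVec a b, ∀ i, v i = (w i : ℚ)) (x : ℝ) :
    ∃ μ : LVec a b,
      |((BLQ a b (v - fun i => ((μ i : ℚ))) (v - fun i => ((μ i : ℚ))) : ℚ) : ℝ) - x| < 1 := by
  by_cases hU : ∃ k s, ¬ ∃ z : ℤ, v (Sum.inl (k, s)) = z
  · obtain ⟨k, s, hs⟩ := hU
    fin_cases s
    · obtain ⟨m, n, h⟩ := exists_int_hyperbolic_close _ (v (Sum.inl (k, 1))) (BLQ a b v v) hs x
      refine ⟨hyperbolicVec a b k m n, ?_⟩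
      rw [BLQ_sub_hyperbolicVec]
      exact h
    · obtain ⟨n, m, h⟩ := exists_int_hyperbolic_close _ (v (Sum.inl (k, 0))) (BLQ a b v v) hs x
      refine ⟨hyperbolicVec a b k m n, ?_⟩
      rw [BLQ_sub_hyperbolicVec]
      convert h using 4
      simp only [Fin.mk_one]
      ring
  · push Not at hU
    obtain ⟨k, s, hs⟩ : ∃ k s, ¬ ∃ z : ℤ, v (Sum.inr (k, s)) = z := by
      by_contra! hE
      refine hv ⟨fun i => ⌊v i⌋, ?_⟩
      rintro (⟨k, s⟩ | ⟨k, s⟩)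
      · obtain ⟨z, hz⟩ := hU k s
        simp [hz]
      · obtain ⟨z, hz⟩ := hE k s
        simp [hz]
    let k₀ : Fin a := ⟨0, ha⟩
    obtain ⟨p, hp⟩ := hU k₀ 0
    obtain ⟨q, hq⟩ := hU k₀ 1
    set u : LIdx a b → ℚ := fun i => (dualE₈Vec a b k s i : ℚ) with hu
    obtain ⟨h, hh⟩ := even_cartanE₈Inv_diag s
    have hvu : BLQ a b (v - u) (v - u) = BLQ a b v v + 2 * v (Sum.inr (k, s)) - 2 * h := by
      rw [BLQ_sub_self, hu, BLQ_dualE₈Vec, BLQ_dualE₈Vec]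
      simp [dualE₈Vec, hh]
      ring
    rcases exists_even_translate_close_or_odd ((BLQ a b v v : ℝ) - x) with ⟨n, hn⟩ | ⟨n, hn⟩
    · obtain ⟨μ, hμ⟩ := exists_BLQ_sub_eq_add_two_mul a b k₀ v p q hp hq n
      refine ⟨μ, ?_⟩
      rw [hμ]
      push_cast
      convert hn using 2
      ring
    rcases exists_even_translate_close_or_odd ((BLQ a b (v - u) (v - u) : ℝ) - x) with
      ⟨n', hn'⟩ | ⟨n', hn'⟩
    · obtain ⟨μ, hμ⟩ := exists_BLQ_sub_eq_add_two_mul a b k₀ (v - u) p q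
        (by simp [hu, dualE₈Vec, hp]) (by simp [hu, dualE₈Vec, hq]) n'
      refine ⟨dualE₈Vec a b k s + μ, ?_⟩
      have hsub : (v - fun i => (((dualE₈Vec a b k s + μ) i : ℤ) : ℚ)) =
          v - u - fun i => (μ i : ℚ) := by
        ext i
        simp [hu, sub_sub]
      rw [hsub, hμ]
      push_cast
      convert hn' using 2
      ring
    · refine absurd ⟨n' - n + h, ?_⟩ hs
      rw [hvu] at hn'
      push_cast at hn'
      have : (v (Sum.inr (k, s)) : ℝ) = ((n' - n + h : ℤ) : ℝ) := by
        push_cast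
        linarith
      exact_mod_cast this
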